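/- arXiv:2302.06636 — 2 statements merged into one kernel-verified Lean document; each statement's English description precedes it below -/
import Mathlib

section
/- There exists a numerical constant B>0 such that for every a∈[0,1], every admissible frequency triple (ω,m,Λ) with Λ>0, and every r≥B: dV₀/dr(r) < 0. In particular every critical point of V₀ in [1,∞) lies in [1,B). (This is part (ii) of Lemma 5.2: the location of the maximum of V₀ is bounded uniformly over all admissible frequencies and all a.) -/
noncomputable section

/-- Normalized (horizon radius `r₊ = 1`) `Δ(r) = (r−1)(r−a²)`. -/
def kDelta (a r : ℝ) : ℝ := (r - 1) * (r - a ^ 2)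

/-- `V₀(r) = (r²+a²)⁻²(2ma(1+a²)ωr − a²m² + ΛΔ(r))`. -/
def V0 (a : ℝ) (m : ℤ) (ω Λ r : ℝ) : ℝ :=
  ((r ^ 2 + a ^ 2)⁻¹) ^ 2 *
    (2 * (m : ℝ) * a * (1 + a ^ 2) * ω * r - a ^ 2 * (m : ℝ) ^ 2 + Λ * kDelta a r)

/-- A frequency triple `(ω, m, Λ)` is admissible iff `Λ ≥ max{|m|(|m|+1), 2|mω|}`. -/
def Admissible (m : ℤ) (ω Λ : ℝ) : Prop :=
  max (|(m : ℝ)| * (|(m : ℝ)| + 1)) (2 * |(m : ℝ) * ω|) ≤ Λ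

theorem hasDerivAt_V0 (a : ℝ) (m : ℤ) (ω Λ : ℝ) {r : ℝ} (hr : r ^ 2 + a ^ 2 ≠ 0) :
    HasDerivAt (V0 a m ω Λ)
      ((((2 * (m : ℝ) * a * (1 + a ^ 2) * ω) + Λ * (2 * r - 1 - a ^ 2)) * (r ^ 2 + a ^ 2) -
        4 * r * (2 * (m : ℝ) * a * (1 + a ^ 2) * ω * r - a ^ 2 * (m : ℝ) ^ 2 + Λ * kDelta a r)) /
          (r ^ 2 + a ^ 2) ^ 3) r := by
  have hden : HasDerivAt (fun x : ℝ => x ^ 2 + a ^ 2) (2 * r) r := by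
    simpa using (hasDerivAt_pow 2 r).add_const (a ^ 2)
  have hDelta : HasDerivAt (kDelta a) (1 * (r - a ^ 2) + (r - 1) * 1) r :=
    ((hasDerivAt_id r).sub_const 1).mul ((hasDerivAt_id r).sub_const (a ^ 2))
  have hnum := (((hasDerivAt_id r).const_mul (2 * (m : ℝ) * a * (1 + a ^ 2) * ω)).sub_const
    (a ^ 2 * (m : ℝ) ^ 2)).add (hDelta.const_mul Λ)
  have h := ((hden.inv hr).pow 2).mul hnum
  refine h.congr_deriv ?_
  simp only [Pi.add_apply, Pi.pow_apply, Pi.inv_apply, id, Nat.add_one_sub_one, pow_one, Nat.cast_ofNat]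
  field_simp
  ring

theorem deriv_V0_neg {a : ℝ} (ha : a ∈ Set.Icc (0 : ℝ) 1) {m : ℤ} {ω Λ r : ℝ}
    (hadm : Admissible m ω Λ) (hΛ : 0 < Λ) (hr : 7 ≤ r) : deriv (V0 a m ω Λ) r < 0 := by
  obtain ⟨ha0, ha1⟩ := ha
  obtain ⟨h1, h2⟩ := max_le_iff.mp hadm
  have ha2 : a ^ 2 ≤ 1 := pow_le_one₀ ha0 ha1
  have hpos : 0 < r ^ 2 + a ^ 2 := by positivity
  rw [(hasDerivAt_V0 a m ω Λ hpos.ne').deriv]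
  refine div_neg_of_neg_of_pos ?_ (by positivity)
  have hm : a ^ 2 * (m : ℝ) ^ 2 ≤ Λ := by
    have : (m : ℝ) ^ 2 ≤ Λ := by nlinarith [sq_abs (m : ℝ), abs_nonneg (m : ℝ)]
    nlinarith [sq_nonneg (m : ℝ)]
  have hb : -(2 * Λ) ≤ 2 * (m : ℝ) * a * (1 + a ^ 2) * ω := by
    have hmω : -Λ ≤ 2 * ((m : ℝ) * ω) := by linarith [neg_abs_le ((m : ℝ) * ω)]
    have hc0 : 0 ≤ a * (1 + a ^ 2) := by positivity
    have hc2 : a * (1 + a ^ 2) ≤ 2 := by nlinarith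
    calc -(2 * Λ) ≤ a * (1 + a ^ 2) * -Λ := by nlinarith
      _ ≤ a * (1 + a ^ 2) * (2 * ((m : ℝ) * ω)) := mul_le_mul_of_nonneg_left hmω hc0
      _ = _ := by ring
  generalize 2 * (m : ℝ) * a * (1 + a ^ 2) * ω = b at hb ⊢
  have e1 : -b * (3 * r ^ 2 - a ^ 2) ≤ 2 * Λ * (3 * r ^ 2) := by
    have h3 : 0 ≤ 3 * r ^ 2 - a ^ 2 := by nlinarith
    nlinarith [mul_le_mul_of_nonneg_right (neg_le.mp hb) h3, mul_nonneg hΛ.le (sq_nonneg a)]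
  have e2 : 4 * r * (a ^ 2 * (m : ℝ) ^ 2) ≤ 4 * r * Λ :=
    mul_le_mul_of_nonneg_left hm (by linarith)
  have e3 : -2 * r ^ 3 + 3 * (1 + a ^ 2) * r ^ 2 - 2 * r * a ^ 2 - (1 + a ^ 2) * a ^ 2
      + 6 * r ^ 2 + 4 * r < 0 := by
    have h4 : a ^ 2 * r ^ 2 ≤ r ^ 2 := by nlinarith [sq_nonneg r]
    have h5 : 0 ≤ r * a ^ 2 := by positivity
    have h6 : 0 ≤ (1 + a ^ 2) * a ^ 2 := by positivity
    have h7 : 7 * r ^ 2 ≤ r ^ 3 := by nlinarith [sq_nonneg r]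
    nlinarith
  have e4 := mul_neg_of_pos_of_neg hΛ e3
  unfold kDelta
  linarith

/-- part (ii) of Lemma 5.2: there is a numerical constant `B > 0` such that
for every `a ∈ [0,1]` and every admissible `(ω,m,Λ)` with `Λ > 0`, `dV₀/dr(r) < 0` for
all `r ≥ B`; in particular every critical point of `V₀` in `[1,∞)` lies in `[1,B)`. -/
theorem V0_maximum_location_bounded :
    ∃ B > 0, ∀ a ∈ Set.Icc (0 : ℝ) 1, ∀ m : ℤ, ∀ ω Λ : ℝ, Admissible m ω Λ → 0 < Λ →
      (∀ r : ℝ, B ≤ r → deriv (V0 a m ω Λ) r < 0) ∧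
      (∀ r : ℝ, 1 ≤ r → deriv (V0 a m ω Λ) r = 0 → r < B) := by
  refine ⟨7, by norm_num, fun a ha m ω Λ hadm hΛ => ⟨fun r hr => deriv_V0_neg ha hadm hΛ hr,
    fun r _ h0 => ?_⟩⟩
  by_contra! hr
  exact (deriv_V0_neg ha hadm hΛ hr).ne h0
end
end

section
/- Fix p∈(0,2). There exist R_∞>2, a smooth nondecreasing cutoff χ:[1,∞)→[0,1] with χ≡0 on [1,R_∞−1] and χ≡1 on [R_∞,∞), and a constant C>0, all depending only on p, with the following property. Let a∈[0,1], let (ω,m,Λ) be an admissible frequency triple with m≠0, let u∈C²((1,∞);ℂ) and H∈C⁰((1,∞);ℂ) satisfy the radial ODE D(Du) + (ω²−V)u = H on (1,∞), where Dƒ(r):=Δ(r)(r²+a²)⁻¹·dƒ/dr, and assume that r^p·|Du−iωu|²(r) → 0 as r→∞ and that ∫₁^∞ r^p |Du−iωu| |H| (r²+a²)Δ⁻¹ dr < ∞. Then ∫_{R_∞}^∞ [ ½ p r^{p−1} |Du−iωu|² + ¼(2−p) Λ r^{p−3} |u|² ] dr ≤ C ∫_{R_∞−1}^{R_∞} Λ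 r^{p−2} |u|² dr − ∫₁^∞ r^p χ(r) · Re( (Du−iωu)·conj(H) ) · (r²+a²)Δ(r)⁻¹ dr. (This is the r^p-weighted far-region estimate of Proposition 6.1(i).) -/
noncomputable section

open MeasureTheory

/-- `V₁(r) = (r²+a²)⁻³Δ(r)(3r²−2(1+a²)r+a²) − 3(r²+a²)⁻⁴Δ(r)²r²`. -/
def V1 (a r : ℝ) : ℝ :=
  ((r ^ 2 + a ^ 2)⁻¹) ^ 3 * kDelta a r * (3 * r ^ 2 - 2 * (1 + a ^ 2) * r + a ^ 2)
    - 3 * ((r ^ 2 + a ^ 2)⁻¹) ^ 4 * kDelta a r ^ 2 * r ^ 2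

/-- `V = V₀ + V₁`. -/
def Vpot (a : ℝ) (m : ℤ) (ω Λ r : ℝ) : ℝ := V0 a m ω Λ r + V1 a r

/-- `D f(r) = Δ(r)(r²+a²)⁻¹ f′(r)`, i.e. `d/dr_*` expressed in the `r` variable. -/
def Dop (a : ℝ) (u : ℝ → ℂ) (r : ℝ) : ℂ :=
  ((kDelta a r * (r ^ 2 + a ^ 2)⁻¹ : ℝ) : ℂ) * deriv u r


lemma Admissible.abs_le {m : ℤ} {ω Λ : ℝ} (h : Admissible m ω Λ) (hm : m ≠ 0) :
    2 ≤ Λ ∧ (m : ℝ) ^ 2 ≤ Λ ∧ |2 * (m : ℝ) * ω| ≤ Λ := by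
  have h1 : |(m : ℝ)| * (|(m : ℝ)| + 1) ≤ Λ := (le_max_left _ _).trans h
  have h2 : 2 * |(m : ℝ) * ω| ≤ Λ := (le_max_right _ _).trans h
  have h3 : (1 : ℝ) ≤ |(m : ℝ)| := by exact_mod_cast Int.one_le_abs hm
  refine ⟨by nlinarith, by nlinarith [sq_abs (m : ℝ)], ?_⟩
  rwa [mul_assoc, abs_mul, abs_two]

/-- Partial-fraction form of the potential, with `s = r² + a²`. -/
lemma Vpot_eq (a : ℝ) (m : ℤ) (ω Λ : ℝ) {r : ℝ} (hr : 0 < r) :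
    Vpot a m ω Λ r =
      Λ * (r ^ 2 + a ^ 2)⁻¹
        + (2 * m * ω * (a * (1 + a ^ 2)) - Λ * (1 + a ^ 2)) * (r * ((r ^ 2 + a ^ 2) ^ 2)⁻¹)
        - a ^ 2 * m ^ 2 * ((r ^ 2 + a ^ 2) ^ 2)⁻¹
        + (r - 1) * (r - a ^ 2) * ((1 + a ^ 2) * r ^ 3 + a ^ 2 * r ^ 2
            - 2 * (1 + a ^ 2) * a ^ 2 * r + a ^ 4) * ((r ^ 2 + a ^ 2) ^ 4)⁻¹ := by
  have hs : r ^ 2 + a ^ 2 ≠ 0 := by positivity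
  unfold Vpot V0 V1 kDelta
  field_simp
  ring

/-- The `r`-derivative of `Vpot`. -/
def VpotDeriv (a : ℝ) (m : ℤ) (ω Λ r : ℝ) : ℝ :=
  Λ * (-(2 * r) / (r ^ 2 + a ^ 2) ^ 2)
    + (2 * m * ω * (a * (1 + a ^ 2)) - Λ * (1 + a ^ 2)) *
      ((a ^ 2 - 3 * r ^ 2) / (r ^ 2 + a ^ 2) ^ 3)
    - a ^ 2 * m ^ 2 * (-(4 * r) / (r ^ 2 + a ^ 2) ^ 3)
    + ((2 * r - (1 + a ^ 2)) * ((1 + a ^ 2) * r ^ 3 + a ^ 2 * r ^ 2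
            - 2 * (1 + a ^ 2) * a ^ 2 * r + a ^ 4)
        + (r - 1) * (r - a ^ 2) * (3 * (1 + a ^ 2) * r ^ 2 + 2 * a ^ 2 * r
            - 2 * (1 + a ^ 2) * a ^ 2)) / (r ^ 2 + a ^ 2) ^ 4
    - 8 * r * ((r - 1) * (r - a ^ 2) * ((1 + a ^ 2) * r ^ 3 + a ^ 2 * r ^ 2
            - 2 * (1 + a ^ 2) * a ^ 2 * r + a ^ 4)) / (r ^ 2 + a ^ 2) ^ 5

lemma hasDerivAt_Vpot (a : ℝ) (m : ℤ) (ω Λ : ℝ) {r : ℝ} (hr : 0 < r) :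
    HasDerivAt (Vpot a m ω Λ) (VpotDeriv a m ω Λ r) r := by
  have hs : r ^ 2 + a ^ 2 ≠ 0 := by positivity
  have hs1 : HasDerivAt (fun r : ℝ => r ^ 2 + a ^ 2) (2 * r) r := by
    simpa using (hasDerivAt_pow 2 r).add_const (a ^ 2)
  have hid := hasDerivAt_id' r
  have h1 := (hs1.fun_inv hs).const_mul Λ
  have h2 := (hid.fun_mul ((hs1.fun_pow 2).fun_inv (pow_ne_zero 2 hs))).const_mul
    (2 * m * ω * (a * (1 + a ^ 2)) - Λ * (1 + a ^ 2))
  have h3 := ((hs1.fun_pow 2).fun_inv (pow_ne_zero 2 hs)).const_mul (a ^ 2 * (m : ℝ) ^ 2)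
  have hQ := ((((hid.fun_pow 3).const_mul (1 + a ^ 2)).fun_add
    ((hid.fun_pow 2).const_mul (a ^ 2))).fun_sub
      (hid.const_mul (2 * (1 + a ^ 2) * a ^ 2))).add_const (a ^ 4)
  have h4 := (((hid.sub_const 1).fun_mul (hid.sub_const (a ^ 2))).fun_mul hQ).fun_mul
    ((hs1.fun_pow 4).fun_inv (pow_ne_zero 4 hs))
  have h := ((h1.fun_add h2).fun_sub h3).fun_add h4
  refine (h.congr_of_eventuallyEq ?_).congr_deriv ?_
  · filter_upwards [lt_mem_nhds hr] with x hx using Vpot_eq a m ω Λ hx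
  · unfold VpotDeriv
    push_cast
    field_simp
    ring

lemma abs_div_pow_le {N s r C : ℝ} {k j : ℕ} (hr : 1 ≤ r) (hs : r ^ 2 ≤ s) (hC : 0 ≤ C)
    (hkj : j + 3 ≤ 2 * k) (hN : |N| ≤ C * r ^ j) : |N / s ^ k| ≤ C / r ^ 3 := by
  have hr0 : 0 < r := by linarith
  have hsk : r ^ (j + 3) ≤ s ^ k := calc
    r ^ (j + 3) ≤ r ^ (2 * k) := pow_le_pow_right₀ hr hkj
    _ = (r ^ 2) ^ k := pow_mul ..
    _ ≤ s ^ k := by gcongr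
  have hs0 : 0 < s ^ k := (by positivity : 0 < r ^ (j + 3)).trans_le hsk
  rw [abs_div, abs_of_pos hs0, div_le_div_iff₀ hs0 (by positivity)]
  calc |N| * r ^ 3 ≤ C * r ^ j * r ^ 3 := by gcongr
    _ = C * r ^ (j + 3) := by ring
    _ ≤ C * s ^ k := by gcongr

lemma abs_potential_numerators_le {a r : ℝ} (ha : a ∈ Set.Icc (0 : ℝ) 1) (hr : 1 ≤ r) :
    |(r - 1) * (r - a ^ 2)| ≤ r ^ 2 ∧ |2 * r - (1 + a ^ 2)| ≤ 2 * r ∧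
    |(1 + a ^ 2) * r ^ 3 + a ^ 2 * r ^ 2 - 2 * (1 + a ^ 2) * a ^ 2 * r + a ^ 4| ≤ 8 * r ^ 3 ∧
    |3 * (1 + a ^ 2) * r ^ 2 + 2 * a ^ 2 * r - 2 * (1 + a ^ 2) * a ^ 2| ≤ 12 * r ^ 2 := by
  obtain ⟨ha0, ha1⟩ := ha
  obtain ⟨t, ht⟩ : ∃ t, t = a ^ 2 := ⟨_, rfl⟩
  have ht0 : 0 ≤ t := by rw [ht]; positivity
  have ht1 : t ≤ 1 := by rw [ht]; nlinarith
  have h4 : a ^ 4 = t ^ 2 := by rw [ht]; ring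
  rw [h4, ← ht]
  have hr2 : r ≤ r ^ 2 := by nlinarith
  have hr3 : r ^ 2 ≤ r ^ 3 := by nlinarith [sq_nonneg r]
  have htt : t ^ 2 ≤ t := by nlinarith
  have ht3 : 0 ≤ (1 - t) * r ^ 3 := mul_nonneg (by linarith) (by positivity)
  have ht2 : 0 ≤ (1 - t) * r ^ 2 := mul_nonneg (by linarith) (by positivity)
  have ht1' : 0 ≤ (1 - t) * r := mul_nonneg (by linarith) (by positivity)
  have h03 : 0 ≤ t * r ^ 3 := by positivity
  have h02 : 0 ≤ t * r ^ 2 := by positivity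
  have h01 : 0 ≤ t * r := by positivity
  have h21 : 0 ≤ t ^ 2 * r := by positivity
  have h21' : 0 ≤ (t - t ^ 2) * r := mul_nonneg (by linarith) (by positivity)
  have h20 : 0 ≤ t ^ 2 := by positivity
  refine ⟨?_, ?_, ?_, ?_⟩ <;> rw [abs_le] <;> constructor <;> nlinarith

set_option maxHeartbeats 1000000 in
lemma abs_Vpot_sub_le {a : ℝ} (ha : a ∈ Set.Icc (0 : ℝ) 1) {m : ℤ} (hm : m ≠ 0) {ω Λ : ℝ}
    (h : Admissible m ω Λ) {r : ℝ} (hr : 1 ≤ r) :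
    |Vpot a m ω Λ r - Λ / r ^ 2| ≤ 14 * Λ / r ^ 3 ∧
      |r * VpotDeriv a m ω Λ r + 2 * Vpot a m ω Λ r| ≤ 124 * Λ / r ^ 3 := by
  obtain ⟨hΛ, hmΛ, hmω⟩ := h.abs_le hm
  have hr0 : 0 < r := by linarith
  obtain ⟨hD, hb, hQ, hQ'⟩ := abs_potential_numerators_le ha hr
  obtain ⟨ha0, ha1⟩ := ha
  have ht1 : a ^ 2 ≤ 1 := by nlinarith
  have ht0 : 0 ≤ a ^ 2 := by positivity
  have hc : |2 * m * ω * (a * (1 + a ^ 2)) - Λ * (1 + a ^ 2)| ≤ 4 * Λ := by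
    have h1 : |2 * m * ω * (a * (1 + a ^ 2))| ≤ Λ * 2 := by
      rw [abs_mul, abs_of_nonneg (by positivity : 0 ≤ a * (1 + a ^ 2))]
      have : a * (1 + a ^ 2) ≤ 2 := by nlinarith
      gcongr
    have h2 : |Λ * (1 + a ^ 2)| ≤ Λ * 2 := by
      rw [abs_of_nonneg (by positivity)]
      gcongr
      linarith
    exact (abs_sub _ _).trans (by linarith)
  have hd : a ^ 2 * (m : ℝ) ^ 2 ≤ Λ := by nlinarith [sq_nonneg (m : ℝ)]
  have hd0 : 0 ≤ a ^ 2 * (m : ℝ) ^ 2 := by positivity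
  have hV := Vpot_eq a m ω Λ hr0
  have hs : r ^ 2 ≤ r ^ 2 + a ^ 2 := by linarith
  unfold VpotDeriv
  rw [hV]
  generalize hce : 2 * m * ω * (a * (1 + a ^ 2)) - Λ * (1 + a ^ 2) = c at *
  generalize hde : a ^ 2 * (m : ℝ) ^ 2 = d at *
  generalize hQe : (1 + a ^ 2) * r ^ 3 + a ^ 2 * r ^ 2
            - 2 * (1 + a ^ 2) * a ^ 2 * r + a ^ 4 = Q at *
  generalize hQe' : 3 * (1 + a ^ 2) * r ^ 2 + 2 * a ^ 2 * r
            - 2 * (1 + a ^ 2) * a ^ 2 = Q' at *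
  generalize hDe : (r - 1) * (r - a ^ 2) = D at *
  generalize hbe : 2 * r - (1 + a ^ 2) = D' at *
  have hDQ : |D * Q| ≤ 8 * r ^ 5 := by
    rw [abs_mul]
    calc |D| * |Q| ≤ r ^ 2 * (8 * r ^ 3) := by gcongr
      _ = _ := by ring
  generalize hse : r ^ 2 + a ^ 2 = s at *
  have hs1 : 0 < s := (by positivity : 0 < r ^ 2).trans_le hs
  have hs0 : s ≠ 0 := hs1.ne'
  have e1 : |(-(Λ * a ^ 2) / r ^ 2) / s ^ 1| ≤ Λ / r ^ 3 := by
    rw [div_div, abs_div, abs_neg, abs_of_nonneg (by positivity : 0 ≤ Λ * a ^ 2),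
      abs_of_pos (by positivity : 0 < r ^ 2 * s ^ 1), pow_one]
    have hrs : r ^ 3 ≤ r ^ 2 * s := by
      rw [pow_succ]
      gcongr
      nlinarith
    gcongr
    nlinarith
  have e2 : |(c * r) / s ^ 2| ≤ 4 * Λ / r ^ 3 :=
    abs_div_pow_le (j := 1) hr hs (by positivity) (by norm_num) (by
      rw [abs_mul, abs_of_pos hr0, pow_one]; gcongr)
  have e3 : |d / s ^ 2| ≤ Λ / r ^ 3 :=
    abs_div_pow_le (j := 0) hr hs (by positivity) (by norm_num) (by
      rw [abs_of_nonneg hd0]; simpa using hd)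
  have e4 : |(D * Q) / s ^ 4| ≤ 8 / r ^ 3 :=
    abs_div_pow_le (j := 5) hr hs (by positivity) (by norm_num) hDQ
  have f1 : |(2 * Λ * a ^ 2) / s ^ 2| ≤ (2 * Λ) / r ^ 3 :=
    abs_div_pow_le (j := 0) hr hs (by positivity) (by norm_num) (by
      rw [abs_of_nonneg (by positivity), pow_zero]; gcongr)
  have f2 : |(c * r * (3 * a ^ 2 - r ^ 2)) / s ^ 3| ≤ (12 * Λ) / r ^ 3 :=
    abs_div_pow_le (j := 3) hr hs (by positivity) (by norm_num) (by
      rw [abs_mul, abs_mul, abs_of_pos hr0]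
      have : |3 * a ^ 2 - r ^ 2| ≤ 3 * r ^ 2 := by
        rw [abs_le]; constructor <;> nlinarith
      calc |c| * r * |3 * a ^ 2 - r ^ 2| ≤ 4 * Λ * r * (3 * r ^ 2) := by gcongr
        _ = _ := by ring)
  have f3 : |(d * (2 * r ^ 2 - 2 * a ^ 2)) / s ^ 3| ≤ (2 * Λ) / r ^ 3 :=
    abs_div_pow_le (j := 2) hr hs (by positivity) (by norm_num) (by
      rw [abs_mul, abs_of_nonneg hd0]
      have : |2 * r ^ 2 - 2 * a ^ 2| ≤ 2 * r ^ 2 := by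
        rw [abs_le]; constructor <;> nlinarith
      calc d * |2 * r ^ 2 - 2 * a ^ 2| ≤ Λ * (2 * r ^ 2) := by gcongr
        _ = _ := by ring)
  have f4 : |(r * (D' * Q + D * Q')) / s ^ 4| ≤ 28 / r ^ 3 :=
    abs_div_pow_le (j := 5) hr hs (by positivity) (by norm_num) (by
      rw [abs_mul, abs_of_pos hr0]
      calc r * |D' * Q + D * Q'| ≤ r * (|D' * Q| + |D * Q'|) := by gcongr; exact abs_add_le _ _
        _ = r * (|D'| * |Q| + |D| * |Q'|) := by rw [abs_mul, abs_mul]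
        _ ≤ r * (2 * r * (8 * r ^ 3) + r ^ 2 * (12 * r ^ 2)) := by gcongr
        _ = _ := by ring)
  have f5 : |(8 * r ^ 2 * (D * Q)) / s ^ 5| ≤ 64 / r ^ 3 :=
    abs_div_pow_le (j := 7) hr hs (by positivity) (by norm_num) (by
      rw [abs_mul, abs_of_pos (by positivity : 0 < 8 * r ^ 2)]
      calc 8 * r ^ 2 * |D * Q| ≤ 8 * r ^ 2 * (8 * r ^ 5) := by gcongr
        _ = _ := by ring)
  have hi : 0 < 1 / r ^ 3 := by positivity
  have k1 : 8 / r ^ 3 ≤ 8 * Λ / r ^ 3 := by gcongr; linarith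
  constructor
  · have : Λ * s⁻¹ + c * (r * (s ^ 2)⁻¹) - d * (s ^ 2)⁻¹ + D * Q * (s ^ 4)⁻¹ - Λ / r ^ 2 =
        (-(Λ * a ^ 2) / r ^ 2) / s ^ 1 + (c * r) / s ^ 2 - d / s ^ 2 + (D * Q) / s ^ 4 := by
      field_simp
      rw [← hse]
      ring
    rw [this]
    rw [abs_le] at *
    have : 14 * Λ / r ^ 3 = Λ / r ^ 3 + 4 * Λ / r ^ 3 + Λ / r ^ 3 + 8 * Λ / r ^ 3 := by ring
    constructor <;> linarith
  · have : r * (Λ * (-(2 * r) / s ^ 2) + c * ((a ^ 2 - 3 * r ^ 2) / s ^ 3) - d * (-(4 * r) / s ^ 3)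
          + (D' * Q + D * Q') / s ^ 4 - 8 * r * (D * Q) / s ^ 5)
          + 2 * (Λ * s⁻¹ + c * (r * (s ^ 2)⁻¹) - d * (s ^ 2)⁻¹ + D * Q * (s ^ 4)⁻¹)
        = (2 * Λ * a ^ 2) / s ^ 2 + (c * r * (3 * a ^ 2 - r ^ 2)) / s ^ 3
          + (d * (2 * r ^ 2 - 2 * a ^ 2)) / s ^ 3 + (r * (D' * Q + D * Q')) / s ^ 4
          - (8 * r ^ 2 * (D * Q)) / s ^ 5 + 2 * ((D * Q) / s ^ 4) := by
      field_simp
      rw [← hse]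
      ring
    rw [this]
    rw [abs_le] at *
    have : 124 * Λ / r ^ 3 = 2 * Λ / r ^ 3 + 12 * Λ / r ^ 3 + 2 * Λ / r ^ 3
      + 13.5 * (8 * Λ / r ^ 3) := by ring
    have k2 : 28 / r ^ 3 = 3.5 * (8 / r ^ 3) := by ring
    have k3 : 64 / r ^ 3 = 8 * (8 / r ^ 3) := by ring
    constructor <;> linarith

lemma Vpot_far {p : ℝ} (hp0 : 0 < p) (hp2 : p < 2) {a : ℝ} (ha : a ∈ Set.Icc (0 : ℝ) 1)
    {m : ℤ} (hm : m ≠ 0) {ω Λ : ℝ} (h : Admissible m ω Λ) {r : ℝ} (hr : 304 / (2 - p) ≤ r) :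
    0 ≤ Vpot a m ω Λ r ∧ Vpot a m ω Λ r ≤ 2 * Λ / r ^ 2 ∧
      p * Vpot a m ω Λ r + r * VpotDeriv a m ω Λ r ≤ -(1 / 2 * (2 - p) * Λ / r ^ 2) := by
  have hδ : 0 < 2 - p := by linarith
  have hr' : 304 ≤ r * (2 - p) := by rwa [div_le_iff₀ hδ] at hr
  have hr152 : 152 ≤ r := by nlinarith
  have hr0 : 0 < r := by linarith
  obtain ⟨hΛ, -, -⟩ := h.abs_le hm
  obtain ⟨h1, h2⟩ := abs_Vpot_sub_le ha hm h (by linarith : 1 ≤ r)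
  have e1 : 14 * Λ / r ^ 3 ≤ Λ / r ^ 2 := by
    rw [div_le_div_iff₀ (by positivity) (by positivity)]
    have : 0 < Λ * r ^ 2 := by positivity
    nlinarith
  have e2 : 304 * Λ / r ^ 3 ≤ (2 - p) * Λ / r ^ 2 := by
    rw [div_le_div_iff₀ (by positivity) (by positivity)]
    have : 0 < Λ * r ^ 2 := by positivity
    nlinarith
  rw [abs_le] at h1 h2
  have e3 : 2 * Λ / r ^ 2 = 2 * (Λ / r ^ 2) := by ring
  have e4 : (2 - p) * Λ / r ^ 2 = (2 - p) * (Λ / r ^ 2) := by ring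
  have e5 : 1 / 2 * (2 - p) * Λ / r ^ 2 = 1 / 2 * ((2 - p) * (Λ / r ^ 2)) := by ring
  have e6 : 14 * Λ / r ^ 3 = 14 * (Λ / r ^ 3) := by ring
  have e7 : 124 * Λ / r ^ 3 = 124 * (Λ / r ^ 3) := by ring
  have e8 : 304 * Λ / r ^ 3 = 304 * (Λ / r ^ 3) := by ring
  have hX : 0 < Λ / r ^ 3 := by positivity
  rw [e3, e5]
  rw [e6] at h1 e1
  rw [e7] at h2
  rw [e8, e4] at e2
  refine ⟨by linarith, by linarith, ?_⟩
  nlinarith [mul_le_mul_of_nonneg_left h1.1 hδ.le]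

lemma kDelta_pos {a : ℝ} (ha : a ∈ Set.Icc (0 : ℝ) 1) {r : ℝ} (hr : 1 < r) : 0 < kDelta a r := by
  obtain ⟨ha0, ha1⟩ := ha
  exact mul_pos (by linarith) (by nlinarith)

/-- The outgoing derivative `Du - iωu`. -/
def outgoing (a ω : ℝ) (u : ℝ → ℂ) (r : ℝ) : ℂ := Dop a u r - Complex.I * (ω : ℂ) * u r

lemma differentiableAt_Dop {a : ℝ} {u : ℝ → ℂ} (hu : ContDiffOn ℝ 2 u (Set.Ioi 1))
    {r : ℝ} (hr : 1 < r) : DifferentiableAt ℝ u r ∧ DifferentiableAt ℝ (Dop a u) r := by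
  have h2 : ContDiffOn ℝ (1 + 1) u (Set.Ioi 1) := by
    rw [one_add_one_eq_two]
    exact hu
  have h1 := ((contDiffOn_succ_iff_deriv_of_isOpen isOpen_Ioi).1 h2).2.2
  have hmem : Set.Ioi (1 : ℝ) ∈ nhds r := Ioi_mem_nhds hr
  refine ⟨(hu.differentiableOn (by norm_num)).differentiableAt hmem, ?_⟩
  have h3 := (h1.differentiableOn (by norm_num)).differentiableAt hmem
  have hs : r ^ 2 + a ^ 2 ≠ 0 := by positivity
  have hf : DifferentiableAt ℝ (fun r : ℝ => kDelta a r * (r ^ 2 + a ^ 2)⁻¹) r := by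
    unfold kDelta
    fun_prop (disch := assumption)
  exact hf.hasDerivAt.ofReal_comp.differentiableAt.mul h3

lemma hasDerivAt_energy {p a : ℝ} (ha : a ∈ Set.Icc (0 : ℝ) 1) {m : ℤ} {ω Λ : ℝ}
    {u H : ℝ → ℂ} (hu : ContDiffOn ℝ 2 u (Set.Ioi 1)) {r : ℝ} (hr : 1 < r)
    (hode : Dop a (Dop a u) r + ((ω ^ 2 - Vpot a m ω Λ r : ℝ) : ℂ) * u r = H r)
    {χ : ℝ → ℝ} {χ' : ℝ} (hχ : HasDerivAt χ χ' r) :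
    HasDerivAt
      (fun r => r ^ p * χ r * (‖outgoing a ω u r‖ ^ 2 - Vpot a m ω Λ r * ‖u r‖ ^ 2) / 2)
      ((p * r ^ (p - 1) * χ r + r ^ p * χ') * ‖outgoing a ω u r‖ ^ 2 / 2
        - (r ^ p * χ' * Vpot a m ω Λ r + r ^ (p - 1) * χ r *
            (p * Vpot a m ω Λ r + r * VpotDeriv a m ω Λ r)) * ‖u r‖ ^ 2 / 2
        + r ^ p * χ r * (outgoing a ω u r * (starRingEnd ℂ) (H r)).re * (r ^ 2 + a ^ 2)
            * (kDelta a r)⁻¹) r := by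
  have hr0 : 0 < r := by linarith
  have hΔ := kDelta_pos ha hr
  have hs : 0 < r ^ 2 + a ^ 2 := by positivity
  obtain ⟨d1, d2⟩ := differentiableAt_Dop (a := a) hu hr
  have hu1 := d1.hasDerivAt
  have hw1 : HasDerivAt (outgoing a ω u)
      (deriv (Dop a u) r - Complex.I * (ω : ℂ) * deriv u r) r :=
    d2.hasDerivAt.sub (hu1.const_mul _)
  have hV := hasDerivAt_Vpot a m ω Λ hr0
  have hp : HasDerivAt (fun r : ℝ => r ^ p) (p * r ^ (p - 1)) r :=
    Real.hasDerivAt_rpow_const (Or.inl hr0.ne')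
  have key := ((hp.fun_mul hχ).fun_mul
    (hw1.norm_sq.fun_sub (hV.fun_mul hu1.norm_sq))).div_const 2
  refine key.congr_deriv ?_
  obtain ⟨f, hf⟩ : ∃ f, f = kDelta a r * (r ^ 2 + a ^ 2)⁻¹ := ⟨_, rfl⟩
  have hf0 : f ≠ 0 := by rw [hf]; positivity
  have hfinv : (r ^ 2 + a ^ 2) * (kDelta a r)⁻¹ = f⁻¹ := by rw [hf, mul_inv, inv_inv, mul_comm]
  have hfC : (f : ℂ) ≠ 0 := by exact_mod_cast hf0
  have hDu : deriv u r = (f⁻¹ : ℝ) * (outgoing a ω u r + Complex.I * ω * u r) := by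
    simp only [outgoing, Dop, ← hf]
    push_cast
    field_simp
    ring
  have hDDu : deriv (Dop a u) r - Complex.I * (ω : ℂ) * deriv u r =
      (f⁻¹ : ℝ) * (H r + Vpot a m ω Λ r * u r - Complex.I * ω * outgoing a ω u r) := by
    rw [← hode]
    have h1 : Dop a (Dop a u) r = f * deriv (Dop a u) r := by rw [Dop, ← hf]
    have h2 : outgoing a ω u r = f * deriv u r - Complex.I * (ω : ℂ) * u r := by
      rw [outgoing, Dop, ← hf]
    rw [h1, h2]
    push_cast
    field_simp
    linear_combination (-(ω : ℂ) ^ 2 * u r) * Complex.I_sq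
  rw [hDDu, hDu, mul_assoc (_ * _ * _) (r ^ 2 + a ^ 2), hfinv, Complex.inner, Complex.inner]
  have hrp : r ^ p = r * r ^ (p - 1) := by
    rw [Real.rpow_sub_one hr0.ne']
    field_simp
  generalize outgoing a ω u r = w
  generalize u r = z
  generalize H r = h
  generalize Vpot a m ω Λ r = v
  generalize VpotDeriv a m ω Λ r = v'
  rw [hrp]
  generalize r ^ (p - 1) = q
  simp only [Complex.mul_re, Complex.mul_im, Complex.add_re, Complex.add_im, Complex.sub_re,
    Complex.sub_im, Complex.ofReal_re, Complex.ofReal_im, Complex.I_re, Complex.I_im,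
    Complex.conj_re, Complex.conj_im]
  ring

lemma integral_Ioi_le_of_tendsto {F B : ℝ → ℝ} {A L : ℝ} (hF : ∀ r ∈ Set.Ioi A, 0 ≤ F r)
    (hB : ∀ R ≥ A, ∫ r in A..R, F r ≤ B R)
    (hBL : Filter.Tendsto B Filter.atTop (nhds L)) : ∫ r in Set.Ioi A, F r ≤ L := by
  by_cases hi : IntegrableOn F (Set.Ioi A)
  · refine le_of_tendsto_of_tendsto
      (intervalIntegral_tendsto_integral_Ioi A hi Filter.tendsto_id) hBL ?_
    filter_upwards [Filter.eventually_ge_atTop A] with R hR using hB R hR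
  · rw [integral_undef hi]
    refine ge_of_tendsto hBL ?_
    filter_upwards [Filter.eventually_ge_atTop A] with R hR
    refine le_trans ?_ (hB R hR)
    rw [intervalIntegral.integral_of_le hR]
    exact setIntegral_nonneg measurableSet_Ioc fun x hx => hF x hx.1

/-- Proposition 6.1(i): the `r^p`-weighted far-region estimate. For
`p ∈ (0,2)` there are `R_∞ > 2`, a smooth nondecreasing cutoff `χ` (`χ ≡ 0` on
`[1,R_∞−1]`, `χ ≡ 1` on `[R_∞,∞)`, values in `[0,1]`) and `C > 0`, depending only on
`p`, such that for all `a ∈ [0,1]`, admissible `(ω,m,Λ)` with `m ≠ 0`, and all solutions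
`u` of `D(Du)+(ω²−V)u = H` on `(1,∞)` with outgoing behaviour at `r = ∞`:
`∫_{R_∞}^∞ [½p r^{p−1}|Du−iωu|² + ¼(2−p)Λr^{p−3}|u|²] dr
≤ C∫_{R_∞−1}^{R_∞} Λr^{p−2}|u|² dr − ∫₁^∞ r^p χ Re((Du−iωu)·conj H)(r²+a²)Δ⁻¹ dr`. -/
theorem rp_weighted_far_estimate (p : ℝ) (hp0 : 0 < p) (hp2 : p < 2) :
    ∃ Rinf : ℝ, 2 < Rinf ∧
    ∃ χ : ℝ → ℝ, ContDiff ℝ (⊤ : ℕ∞) χ ∧ MonotoneOn χ (Set.Ici 1) ∧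
      (∀ r : ℝ, 1 ≤ r → χ r ∈ Set.Icc (0 : ℝ) 1) ∧
      (∀ r ∈ Set.Icc (1 : ℝ) (Rinf - 1), χ r = 0) ∧
      (∀ r ∈ Set.Ici Rinf, χ r = 1) ∧
    ∃ C > 0, ∀ a ∈ Set.Icc (0 : ℝ) 1, ∀ m : ℤ, m ≠ 0 → ∀ ω Λ : ℝ, Admissible m ω Λ →
      ∀ u H : ℝ → ℂ, ContDiffOn ℝ 2 u (Set.Ioi 1) → ContinuousOn H (Set.Ioi 1) →
        (∀ r ∈ Set.Ioi (1 : ℝ),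
          Dop a (Dop a u) r + ((ω ^ 2 - Vpot a m ω Λ r : ℝ) : ℂ) * u r = H r) →
        Filter.Tendsto
          (fun r : ℝ => r ^ p * ‖Dop a u r - Complex.I * (ω : ℂ) * u r‖ ^ 2)
          Filter.atTop (nhds 0) →
        IntegrableOn
          (fun r : ℝ => r ^ p * ‖Dop a u r - Complex.I * (ω : ℂ) * u r‖ * ‖H r‖ *
            (r ^ 2 + a ^ 2) * (kDelta a r)⁻¹) (Set.Ioi 1) →
        (∫ r in Set.Ioi Rinf,
            (1 / 2 * p * r ^ (p - 1) * ‖Dop a u r - Complex.I * (ω : ℂ) * u r‖ ^ 2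
              + 1 / 4 * (2 - p) * Λ * r ^ (p - 3) * ‖u r‖ ^ 2))
          ≤ C * (∫ r in Set.Ioc (Rinf - 1) Rinf, Λ * r ^ (p - 2) * ‖u r‖ ^ 2)
            - ∫ r in Set.Ioi (1 : ℝ),
                r ^ p * χ r *
                  ((Dop a u r - Complex.I * (ω : ℂ) * u r) * (starRingEnd ℂ) (H r)).re *
                  (r ^ 2 + a ^ 2) * (kDelta a r)⁻¹ := by
  
  have hδ : 0 < 2 - p := by linarith
  obtain ⟨A, hA⟩ : ∃ A, A = 304 / (2 - p) := ⟨_, rfl⟩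
  have hA1 : 1 < A := by
    rw [hA, lt_div_iff₀ hδ]
    linarith
  obtain ⟨M, hM⟩ := (isCompact_Icc (a := (0 : ℝ)) (b := 1)).exists_bound_of_continuousOn
    ((Real.smoothTransition.contDiff (n := 1)).continuous_deriv le_rfl).continuousOn
  have hM0 : 0 ≤ M := (norm_nonneg _).trans (hM 0 (by simp))
  have hmono : Monotone fun r => Real.smoothTransition (r - A) := fun x y hxy =>
    Real.smoothTransition.monotone (by linarith)
  refine ⟨A + 1, by linarith, fun r => Real.smoothTransition (r - A),
    Real.smoothTransition.contDiff.comp (contDiff_id.sub contDiff_const), hmono.monotoneOn _,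
    fun r _ => ⟨Real.smoothTransition.nonneg _, Real.smoothTransition.le_one _⟩,
    fun r hr => Real.smoothTransition.zero_of_nonpos (by linarith [hr.2]),
    fun r hr => Real.smoothTransition.one_of_one_le (by linarith [Set.mem_Ici.1 hr]),
    M + 1, by linarith, ?_⟩
  intro a ha m hm ω Λ hadm u H hu hH hode hlim hint
  obtain ⟨hΛ, -, -⟩ := hadm.abs_le hm
  have hχ1 : ∀ r, A + 1 ≤ r → Real.smoothTransition (r - A) = 1 := fun r hr =>
    Real.smoothTransition.one_of_one_le (by linarith)
  have hχ0 : ∀ r, r ≤ A → Real.smoothTransition (r - A) = 0 := fun r hr =>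
    Real.smoothTransition.zero_of_nonpos (by linarith)
  have hχd : ∀ r, HasDerivAt (fun r => Real.smoothTransition (r - A))
      (deriv Real.smoothTransition (r - A)) r := fun r =>
    ((Real.smoothTransition.contDiff (n := 1)).differentiable
      (by norm_num) (r - A)).hasDerivAt.comp_sub_const r A
  have hχc : Continuous fun r => Real.smoothTransition (r - A) :=
    continuous_iff_continuousAt.2 fun r => (hχd r).continuousAt
  have hχd0 : ∀ r, 0 ≤ deriv Real.smoothTransition (r - A) := fun r =>
    Real.smoothTransition.monotone.deriv_nonneg
  have hχdM : ∀ r ∈ Set.Icc A (A + 1), deriv Real.smoothTransition (r - A) ≤ M := fun r hr =>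
    (le_abs_self _).trans (hM _ ⟨by linarith [hr.1], by linarith [hr.2]⟩)
  simp only [add_sub_cancel_right]
  change Filter.Tendsto (fun r : ℝ => r ^ p * ‖outgoing a ω u r‖ ^ 2) _ _ at hlim
  change IntegrableOn (fun r : ℝ => r ^ p * ‖outgoing a ω u r‖ * ‖H r‖ *
    (r ^ 2 + a ^ 2) * (kDelta a r)⁻¹) _ at hint
  change (∫ r in Set.Ioi (A + 1), (1 / 2 * p * r ^ (p - 1) * ‖outgoing a ω u r‖ ^ 2
      + 1 / 4 * (2 - p) * Λ * r ^ (p - 3) * ‖u r‖ ^ 2)) ≤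
    (M + 1) * (∫ r in Set.Ioc A (A + 1), Λ * r ^ (p - 2) * ‖u r‖ ^ 2)
      - ∫ r in Set.Ioi (1 : ℝ), r ^ p * Real.smoothTransition (r - A) *
        (outgoing a ω u r * (starRingEnd ℂ) (H r)).re * (r ^ 2 + a ^ 2) * (kDelta a r)⁻¹
  set w := outgoing a ω u with hw
  set G : ℝ → ℝ := fun r => r ^ p * Real.smoothTransition (r - A) *
        (w r * (starRingEnd ℂ) (H r)).re * (r ^ 2 + a ^ 2) * (kDelta a r)⁻¹ with hG
  set F : ℝ → ℝ := fun r => 1 / 2 * p * r ^ (p - 1) * ‖w r‖ ^ 2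
      + 1 / 4 * (2 - p) * Λ * r ^ (p - 3) * ‖u r‖ ^ 2 with hF
  set N : ℝ → ℝ := fun r => Λ * r ^ (p - 2) * ‖u r‖ ^ 2 with hN
  have hpos : ∀ r ∈ Set.Ioi (1 : ℝ), 0 < r := fun r hr => one_pos.trans hr
  have huc : ContinuousOn u (Set.Ioi 1) := hu.continuousOn
  have hwc : ContinuousOn w (Set.Ioi 1) := fun r hr =>
    ((differentiableAt_Dop hu hr).2.continuousAt.sub (continuousAt_const.mul
      (differentiableAt_Dop (a := a) hu hr).1.continuousAt)).continuousWithinAt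
  have hrpow : ∀ q : ℝ, ContinuousOn (fun r : ℝ => r ^ q) (Set.Ioi 1) := fun q =>
    continuousOn_id.rpow_const fun r hr => Or.inl (hpos r hr).ne'
  have hΔc : ContinuousOn (fun r => (kDelta a r)⁻¹) (Set.Ioi 1) := by
    refine ContinuousOn.inv₀ ?_ fun r hr => (kDelta_pos ha hr).ne'
    unfold kDelta
    fun_prop
  have hGc : ContinuousOn G (Set.Ioi 1) := by
    refine ContinuousOn.mul (ContinuousOn.mul (ContinuousOn.mul
      ((hrpow p).mul hχc.continuousOn) ?_) (by fun_prop)) hΔc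
    exact Complex.continuous_re.comp_continuousOn
      (hwc.mul (Complex.continuous_conj.comp_continuousOn hH))
  have hFc : ContinuousOn F (Set.Ioi 1) :=
    ((continuousOn_const.mul (hrpow _)).mul (hwc.norm.pow 2)).add
      ((continuousOn_const.mul (hrpow _)).mul (huc.norm.pow 2))
  have hNc : ContinuousOn N (Set.Ioi 1) :=
    (continuousOn_const.mul (hrpow _)).mul (huc.norm.pow 2)
  have hsub : ∀ {b c : ℝ}, A ≤ b → Set.Icc b c ⊆ Set.Ioi 1 := fun hb x hx =>
    hA1.trans_le (hb.trans hx.1)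
  have hGi : IntegrableOn G (Set.Ioi 1) := by
    refine Integrable.mono' hint (hGc.aestronglyMeasurable measurableSet_Ioi) ?_
    refine (ae_restrict_iff' measurableSet_Ioi).2 (Filter.Eventually.of_forall fun r hr => ?_)
    have hr0 := hpos r hr
    have hΔ := kDelta_pos ha hr
    have h1 : |(w r * (starRingEnd ℂ) (H r)).re| ≤ ‖w r‖ * ‖H r‖ := by
      simpa using Complex.abs_re_le_norm (w r * (starRingEnd ℂ) (H r))
    have h2 := Real.smoothTransition.nonneg (r - A)
    have h3 := Real.smoothTransition.le_one (r - A)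
    rw [hG, Real.norm_eq_abs, abs_mul, abs_mul, abs_mul, abs_mul,
      abs_of_pos (by positivity : 0 < r ^ p), abs_of_nonneg h2,
      abs_of_pos (by positivity : 0 < r ^ 2 + a ^ 2), abs_of_pos (inv_pos.2 hΔ),
      mul_assoc (r ^ p) ‖w r‖]
    gcongr
    exact mul_le_of_le_one_right (by positivity) h3
  have hGA : ∫ r in Set.Ioi (1 : ℝ), G r = ∫ r in Set.Ioi A, G r := by
    refine (setIntegral_eq_of_subset_of_forall_sdiff_eq_zero measurableSet_Ioi
      (Set.Ioi_subset_Ioi hA1.le) fun r hr => ?_)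
    have : r ≤ A := not_lt.1 hr.2
    simp [hG, hχ0 r this]
  have hGiA : IntegrableOn G (Set.Ioi A) := hGi.mono_set (Set.Ioi_subset_Ioi hA1.le)
  have hNi : IntervalIntegrable N volume A (A + 1) :=
    (hNc.mono (hsub le_rfl)).intervalIntegrable_of_Icc (by linarith)
  have hGint : ∀ {b c : ℝ}, A ≤ b → b ≤ c → IntervalIntegrable G volume b c := fun hb hc =>
    (hGc.mono (hsub hb)).intervalIntegrable_of_Icc hc
  have hmul : ∀ r ∈ Set.Ioi (1 : ℝ), ∀ q : ℝ, ∀ n : ℕ, r ^ q / r ^ n = r ^ (q - n) :=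
    fun r hr q n => by rw [Real.rpow_sub (hpos r hr), Real.rpow_natCast]
  set E : (ℝ → ℝ) → ℝ → ℝ := fun χ r =>
    r ^ p * χ r * (‖w r‖ ^ 2 - Vpot a m ω Λ r * ‖u r‖ ^ 2) / 2 with hE
  have near : ∫ r in A..(A + 1), (G r - (M + 1) * N r) ≤
      E (fun r => Real.smoothTransition (r - A)) (A + 1)
        - E (fun r => Real.smoothTransition (r - A)) A := by
    refine intervalIntegral.integral_le_sub_of_hasDeriv_right_of_le (by linarith)
      (fun r hr => ((hasDerivAt_energy ha hu (hsub le_rfl hr) (hode r (hsub le_rfl hr))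
        (hχd r)).continuousAt.continuousWithinAt))
      (fun r hr => ((hasDerivAt_energy ha hu (hsub le_rfl (Set.Ioo_subset_Icc_self hr))
        (hode r (hsub le_rfl (Set.Ioo_subset_Icc_self hr))) (hχd r)).hasDerivWithinAt))
      (((hGc.sub (continuousOn_const.mul hNc)).mono (hsub le_rfl)).integrableOn_Icc) ?_
    intro r hr'
    have hr := Set.Ioo_subset_Icc_self hr'
    have hr1 : 1 < r := hsub le_rfl hr
    have hr0 : 0 < r := by linarith
    obtain ⟨hV0, hV2, hV'⟩ := Vpot_far hp0 hp2 ha hm hadm (hA ▸ hr.1)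
    have hc0 := Real.smoothTransition.nonneg (r - A)
    have hd0 := hχd0 r
    have hdM := hχdM r hr
    have h1 : 0 ≤ (p * r ^ (p - 1) * Real.smoothTransition (r - A)
        + r ^ p * deriv Real.smoothTransition (r - A)) * ‖w r‖ ^ 2 / 2 := by positivity
    have h2 : r ^ p * deriv Real.smoothTransition (r - A) * Vpot a m ω Λ r
        ≤ 2 * (M * (Λ * r ^ (p - 2))) := by
      calc _ ≤ r ^ p * M * (2 * Λ / r ^ 2) := by gcongr
        _ = 2 * (M * (Λ * (r ^ p / r ^ 2))) := by ring
        _ = _ := by rw [hmul r hr1]; norm_num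
    have h3 : r ^ (p - 1) * Real.smoothTransition (r - A) *
        (p * Vpot a m ω Λ r + r * VpotDeriv a m ω Λ r) ≤ 0 := by
      refine mul_nonpos_of_nonneg_of_nonpos (by positivity) (hV'.trans ?_)
      have : 0 ≤ 1 / 2 * (2 - p) * Λ / r ^ 2 := by positivity
      linarith
    have h4 : (r ^ p * deriv Real.smoothTransition (r - A) * Vpot a m ω Λ r
        + r ^ (p - 1) * Real.smoothTransition (r - A) *
          (p * Vpot a m ω Λ r + r * VpotDeriv a m ω Λ r)) * ‖u r‖ ^ 2 / 2
        ≤ (M + 1) * N r := by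
      have : 0 ≤ Λ * r ^ (p - 2) := by positivity
      calc _ ≤ (2 * ((M + 1) * (Λ * r ^ (p - 2)))) * ‖u r‖ ^ 2 / 2 := by
            gcongr
            linarith
        _ = _ := by rw [hN]; ring
    rw [hG]
    linarith
  have far : ∀ R ≥ A + 1, ∫ r in (A + 1)..R, (G r + F r) ≤
      E (fun _ => 1) R - E (fun _ => 1) (A + 1) := by
    intro R hR
    have hA' : A ≤ A + 1 := by linarith
    refine intervalIntegral.integral_le_sub_of_hasDeriv_right_of_le hR
      (fun r hr => ((hasDerivAt_energy ha hu (hsub hA' hr) (hode r (hsub hA' hr))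
        (hasDerivAt_const r 1)).continuousAt.continuousWithinAt))
      (fun r hr => ((hasDerivAt_energy ha hu (hsub hA' (Set.Ioo_subset_Icc_self hr))
        (hode r (hsub hA' (Set.Ioo_subset_Icc_self hr)))
        (hasDerivAt_const r 1)).hasDerivWithinAt))
      (((hGc.add hFc).mono (hsub hA')).integrableOn_Icc) ?_
    intro r hr'
    have hr := Set.Ioo_subset_Icc_self hr'
    have hr1 : 1 < r := hsub hA' hr
    have hr0 : 0 < r := by linarith
    obtain ⟨-, -, hV'⟩ := Vpot_far hp0 hp2 ha hm hadm (hA ▸ hA'.trans hr.1)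
    have h1 : r ^ (p - 1) * (p * Vpot a m ω Λ r + r * VpotDeriv a m ω Λ r) * ‖u r‖ ^ 2 / 2
        ≤ -(1 / 4 * (2 - p) * Λ * r ^ (p - 3) * ‖u r‖ ^ 2) := by
      calc _ ≤ r ^ (p - 1) * -(1 / 2 * (2 - p) * Λ / r ^ 2) * ‖u r‖ ^ 2 / 2 := by gcongr
        _ = -(1 / 4 * (2 - p) * Λ * (r ^ (p - 1) / r ^ 2) * ‖u r‖ ^ 2) := by ring
        _ = _ := by
          rw [hmul r hr1, show p - 1 - (2 : ℕ) = p - 3 by push_cast; ring]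
    rw [hG, hF]
    simp only [hχ1 r hr.1, mul_one, mul_zero, add_zero, zero_mul, zero_add]
    linarith
  have hEA : E (fun r => Real.smoothTransition (r - A)) A = 0 := by
    simp [hE]
  have hEA1 : E (fun r => Real.smoothTransition (r - A)) (A + 1) = E (fun _ => 1) (A + 1) := by
    simp [hE]
  have hER : ∀ R ≥ A + 1, E (fun _ => 1) R ≤ R ^ p * ‖w R‖ ^ 2 / 2 := by
    intro R hR
    have hR0 : 0 < R := by linarith
    have hV0 := (Vpot_far hp0 hp2 ha hm hadm (r := R) (by linarith)).1
    have : 0 ≤ R ^ p * (Vpot a m ω Λ R * ‖u R‖ ^ 2) := by positivity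
    simp only [hE]
    linarith
  rw [hGA, ← intervalIntegral.integral_of_le (by linarith : A ≤ A + 1)]
  refine integral_Ioi_le_of_tendsto (B := fun R => (M + 1) * (∫ r in A..(A + 1), N r)
    - (∫ r in A..R, G r) + R ^ p * ‖w R‖ ^ 2 / 2) ?_ ?_ ?_
  · intro r hr
    have hr0 : 0 < r := by linarith [Set.mem_Ioi.1 hr]
    positivity
  · intro R hR
    have h1 := far R hR
    rw [intervalIntegral.integral_sub (hGint le_rfl (by linarith)) (hNi.const_mul _),
      intervalIntegral.integral_const_mul, hEA, hEA1] at near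
    rw [intervalIntegral.integral_add (hGint (by linarith) hR)
      ((hFc.mono (hsub (by linarith))).intervalIntegrable_of_Icc hR)] at h1
    have h2 := intervalIntegral.integral_add_adjacent_intervals
      (hGint le_rfl (by linarith : A ≤ A + 1)) (hGint (by linarith) hR)
    have h3 := hER R hR
    linarith
  · have h1 := intervalIntegral_tendsto_integral_Ioi A hGiA Filter.tendsto_id
    have h2 := (tendsto_const_nhds (x := (M + 1) * ∫ r in A..(A + 1), N r)).sub h1
    simpa using h2.add (hlim.div_const 2)
end
end
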